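/- arXiv:2503.17130 — 2 statements merged into one kernel-verified Lean document; each statement's English description precedes it below -/
import Mathlib

section
/- Let k be a field, C a category, H, H' : C ⥤ ModuleCat k functors, and θ : H ⟶ H' a natural transformation. Let δ ≥ 0 and let F, G be ℝ-diagrams in C that are δ-interleaved. Then the kernel persistence modules ker_θ(F) and ker_θ(G) are δ-interleaved (an interleaving is given by the restrictions of H(φ_r) and H(ψ_r) to the kernels, which are well-defined by naturality of θ). -/
open CategoryTheory

variable {k : Type*} [Field k]

/-- The image of a natural transformation of persistence modules: pointwise the range,
with structure maps the restrictions of those of the target (well defined by naturality). -/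
noncomputable def imgFunctor {M N : ℝ ⥤ ModuleCat k} (f : M ⟶ N) : ℝ ⥤ ModuleCat k where
  obj r := ModuleCat.of k (LinearMap.range (f.app r).hom)
  map {s t} h := ModuleCat.ofHom <| (N.map h).hom.restrict (p := LinearMap.range (f.app s).hom)
    (q := LinearMap.range (f.app t).hom) (fun x hx => by
      obtain ⟨y, rfl⟩ := hx
      refine ⟨M.map h y, ?_⟩
      have : (M.map h ≫ f.app t) y = (f.app s ≫ N.map h) y := by rw [f.naturality h]
      exact this)
  map_id r := by
    ext x
    show N.map (𝟙 r) x.val = x.val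
    simp
  map_comp {s t u} h h' := by
    ext x
    show N.map (h ≫ h') x.val = N.map h' (N.map h x.val)
    simp

/-- The kernel of a natural transformation of persistence modules: pointwise the kernel,
with structure maps the restrictions of those of the source (well defined by naturality). -/
noncomputable def kerFunctor {M N : ℝ ⥤ ModuleCat k} (f : M ⟶ N) : ℝ ⥤ ModuleCat k where
  obj r := ModuleCat.of k (LinearMap.ker (f.app r).hom)
  map {s t} h := ModuleCat.ofHom <| (M.map h).hom.restrict (p := LinearMap.ker (f.app s).hom)
    (q := LinearMap.ker (f.app t).hom) (fun x hx => by
      simp only [LinearMap.mem_ker] at hx ⊢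
      have : (M.map h ≫ f.app t) x = (f.app s ≫ N.map h) x := by rw [f.naturality h]
      show (M.map h ≫ f.app t) x = 0
      rw [this]
      show N.map h (f.app s x) = 0
      rw [hx]
      simp)
  map_id r := by
    ext x
    show M.map (𝟙 r) x.val = x.val
    simp
  map_comp {s t u} h h' := by
    ext x
    show M.map (h ≫ h') x.val = M.map h' (M.map h x.val)
    simp

/-- Given a natural transformation `θ : H ⟶ H'` (a linear cohomology operation) and an
`ℝ`-diagram `F` in `C`, the induced natural transformation `θF : F ⋙ H ⟶ F ⋙ H'`
of persistence modules. -/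
def thetaF {C : Type*} [Category C] {H H' : C ⥤ ModuleCat k} (θ : H ⟶ H')
    (F : ℝ ⥤ C) : (F ⋙ H) ⟶ (F ⋙ H') :=
  Functor.whiskerLeft F θ

/-- `img_θ(F)`, the image persistence module of the operation `θ` on the diagram `F`. -/
noncomputable def imgTheta {C : Type*} [Category C] {H H' : C ⥤ ModuleCat k} (θ : H ⟶ H')
    (F : ℝ ⥤ C) : ℝ ⥤ ModuleCat k :=
  imgFunctor (thetaF θ F)

/-- `ker_θ(F)`, the kernel persistence module of the operation `θ` on the diagram `F`. -/
noncomputable def kerTheta {C : Type*} [Category C] {H H' : C ⥤ ModuleCat k} (θ : H ⟶ H')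
    (F : ℝ ⥤ C) : ℝ ⥤ ModuleCat k :=
  kerFunctor (thetaF θ F)

/-- Two `ℝ`-diagrams `F G : ℝ ⥤ C` are `δ`-interleaved (for `δ ≥ 0`) if there are
families of morphisms `φ_r : F r ⟶ G (r + δ)` and `ψ_r : G r ⟶ F (r + δ)`, natural in `r`,
whose composites recover the structure maps `F (r ≤ r + 2δ)` and `G (r ≤ r + 2δ)`. -/
def Interleaved {C : Type*} [Category C] (δ : ℝ) (hδ : 0 ≤ δ) (F G : ℝ ⥤ C) : Prop :=
  ∃ (φ : ∀ r : ℝ, F.obj r ⟶ G.obj (r + δ)) (ψ : ∀ r : ℝ, G.obj r ⟶ F.obj (r + δ)),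
    (∀ (s t : ℝ) (h : s ≤ t),
        F.map (homOfLE h) ≫ φ t = φ s ≫ G.map (homOfLE (add_le_add_left h δ))) ∧
    (∀ (s t : ℝ) (h : s ≤ t),
        G.map (homOfLE h) ≫ ψ t = ψ s ≫ F.map (homOfLE (add_le_add_left h δ))) ∧
    (∀ r : ℝ, φ r ≫ ψ (r + δ) =
        F.map (homOfLE (by linarith : r ≤ r + δ + δ))) ∧
    (∀ r : ℝ, ψ r ≫ φ (r + δ) =
        G.map (homOfLE (by linarith : r ≤ r + δ + δ)))

/-- The functor `C ⥤ ModuleCat k` sending `X` to the kernel of `θ_X`, with a morphism acting by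
the restriction of its image under `H`. -/
noncomputable def kerNatTrans {C : Type*} [Category C] {H H' : C ⥤ ModuleCat k} (θ : H ⟶ H') :
    C ⥤ ModuleCat k where
  obj X := ModuleCat.of k (LinearMap.ker (θ.app X).hom)
  map {X Y} a := ModuleCat.ofHom <| (H.map a).hom.restrict (p := LinearMap.ker (θ.app X).hom)
    (q := LinearMap.ker (θ.app Y).hom) (fun x hx => by
      rw [LinearMap.mem_ker] at hx ⊢
      have hnat : θ.app Y (H.map a x) = H'.map a (θ.app X x) :=
        ConcreteCategory.congr_hom (θ.naturality a) x
      exact hnat.trans ((congrArg (H'.map a) hx).trans (map_zero (H'.map a).hom)))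
  map_id X := by
    ext x
    show H.map (𝟙 X) x.val = x.val
    simp
  map_comp a b := by
    ext x
    show H.map (a ≫ b) x.val = H.map b (H.map a x.val)
    simp

theorem kerTheta_eq_comp {C : Type*} [Category C] {H H' : C ⥤ ModuleCat k} (θ : H ⟶ H')
    (F : ℝ ⥤ C) : kerTheta θ F = F ⋙ kerNatTrans θ :=
  rfl

/-- Postcomposition with a functor preserves interleavings. -/
theorem Interleaved.comp {C D : Type*} [Category C] [Category D] {δ : ℝ} {hδ : 0 ≤ δ}
    {F G : ℝ ⥤ C} (h : Interleaved δ hδ F G) (K : C ⥤ D) :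
    Interleaved δ hδ (F ⋙ K) (G ⋙ K) := by
  obtain ⟨φ, ψ, hφ, hψ, hφψ, hψφ⟩ := h
  refine ⟨fun r => K.map (φ r), fun r => K.map (ψ r), fun s t hst => ?_, fun s t hst => ?_,
    fun r => ?_, fun r => ?_⟩
  · simp only [Functor.comp_map, ← K.map_comp, hφ s t hst]
  · simp only [Functor.comp_map, ← K.map_comp, hψ s t hst]
  · simp only [Functor.comp_map, ← K.map_comp, hφψ]
  · simp only [Functor.comp_map, ← K.map_comp, hψφ]

/-- If `F` and `G` are `δ`-interleaved `ℝ`-diagrams in `C`, then the kernel persistence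
modules `ker_θ(F)` and `ker_θ(G)` are `δ`-interleaved. -/
theorem kerTheta_interleaved {C : Type*} [Category C]
    {H H' : C ⥤ ModuleCat k} (θ : H ⟶ H') (δ : ℝ) (hδ : 0 ≤ δ) (F G : ℝ ⥤ C)
    (h : Interleaved δ hδ F G) :
    Interleaved δ hδ (kerTheta θ F) (kerTheta θ G) := by
  rw [kerTheta_eq_comp, kerTheta_eq_comp]
  exact h.comp (kerNatTrans θ)
end

section
/- Let n ≥ 1 and q ≥ 2 be natural numbers, let ω = exp(2πi/q) ∈ ℂ, and let r be a real number with 0 < r ≤ 2π/(q(q+1)). Let x_0, x_1, …, x_k be unit vectors in EuclideanSpace ℂ (Fin n) such that for all 0 ≤ i, j ≤ k there exists an integer a with d_S(x_i, ω^a • x_j) < r (i.e., the orbits of the x_i under the scalar C_q-action have pairwise quotient distance < r). Then there exist integers a_1, …, a_k such that, setting x_0* = x_0 and x_i* = ω^{a_i} • x_i, one has d_S(x_i*, x_j*) < r for all 0 ≤ i, j ≤ k; moreover the a_i are unique modulo q: if b_1, …, b_k also satisfy d_S(x_0, ω^{b_i} • x_i) < r for all i, then b_i ≡ a_i (mod q)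 for every i. (This says the canonical C_q-action on the unit sphere is a strong r-diameter action.) -/
open Real

/-- The geodesic distance on the unit sphere of a complex inner product space:
`d_S(x, y) = arccos (re ⟪x, y⟫)`. -/
noncomputable def sphereDist {E : Type*} [NormedAddCommGroup E] [InnerProductSpace ℂ E]
    (x y : E) : ℝ :=
  Real.arccos (inner ℂ x y : ℂ).re

section SphereDist

variable {E : Type*} [NormedAddCommGroup E] [InnerProductSpace ℂ E]

theorem sphereDist_comm (x y : E) : sphereDist x y = sphereDist y x := by
  simp only [sphereDist, ← inner_conj_symm y x, Complex.conj_re]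

theorem sphereDist_self {x : E} (hx : ‖x‖ = 1) : sphereDist x x = 0 := by
  simp [sphereDist, inner_self_eq_norm_sq_to_K, hx]

/-- On unit vectors, the sphere distance satisfies the triangle inequality. -/
theorem sphereDist_triangle {x y z : E} (hx : ‖x‖ = 1) (hy : ‖y‖ = 1) (hz : ‖z‖ = 1) :
    sphereDist x z ≤ sphereDist x y + sphereDist y z := by
  let _ : InnerProductSpace ℝ E := InnerProductSpace.rclikeToReal ℂ E
  have h : ∀ u v : E, ‖u‖ = 1 → ‖v‖ = 1 → sphereDist u v = InnerProductGeometry.angle u v := by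
    intro u v hu hv
    simp only [sphereDist, InnerProductGeometry.angle, hu, hv, mul_one, div_one]
    rfl
  rw [h x z hx hz, h x y hx hy, h y z hy hz]
  exact InnerProductGeometry.angle_le_angle_add_angle x y z

/-- Multiplication by a complex number of modulus one preserves the sphere distance. -/
theorem sphereDist_smul_smul {c : ℂ} (hc : ‖c‖ = 1) (x y : E) :
    sphereDist (c • x) (c • y) = sphereDist x y := by
  have h : c * (starRingEnd ℂ) c = 1 := by
    rw [Complex.mul_conj, Complex.normSq_eq_norm_sq, hc]
    simp
  rw [sphereDist, sphereDist, inner_smul_left, inner_smul_right, ← mul_assoc,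
    mul_comm ((starRingEnd ℂ) c), h, one_mul]

theorem sphereDist_self_smul {x : E} (hx : ‖x‖ = 1) (c : ℂ) :
    sphereDist x (c • x) = arccos c.re := by
  simp [sphereDist, inner_self_eq_norm_sq_to_K, hx]

end SphereDist

/-- A multiple of `2π / q` at angular distance less than `2π / q` from the origin is a multiple
of `2π`. -/
theorem dvd_of_arccos_cos_lt {q : ℕ} (hq : 2 ≤ q) {a : ℤ}
    (h : arccos (cos (2 * π * a / q)) < 2 * π / q) : (q : ℤ) ∣ a := by
  have hq' : (0 : ℝ) < q := by positivity
  have hq2 : (2 : ℝ) ≤ q := by exact_mod_cast hq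
  have hqz : (0 : ℤ) < q := by exact_mod_cast hq'
  have hπ := pi_pos
  by_contra hdvd
  have hm0 : 0 < a % q := lt_of_le_of_ne (Int.emod_nonneg a hqz.ne')
    fun h0 => hdvd (Int.dvd_of_emod_eq_zero h0.symm)
  have hmq : a % q < q := Int.emod_lt_of_pos a hqz
  have hcos : cos (2 * π * a / q) = cos (2 * π * (a % q : ℤ) / q) := by
    have ha : (a : ℝ) = (a % q : ℤ) + q * (a / q : ℤ) := by
      exact_mod_cast (Int.emod_add_mul_ediv a q).symm
    rw [← cos_add_int_mul_two_pi (2 * π * (a % q : ℤ) / q) (a / q)]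
    congr 1
    rw [ha]
    field_simp
  rw [hcos] at h
  generalize a % q = m at h hm0 hmq
  have hm1 : (1 : ℝ) ≤ m := by exact_mod_cast hm0
  have hmq1 : (m : ℝ) + 1 ≤ q := by exact_mod_cast hmq
  rcases le_total (2 * π * m / q) π with hle | hge
  · rw [arccos_cos (by positivity) hle, div_lt_div_iff_of_pos_right hq'] at h
    nlinarith
  · have hlt : 2 * π * m / q ≤ 2 * π - 2 * π / q := by
      rw [le_sub_iff_add_le, ← add_div, div_le_iff₀ hq']
      nlinarith
    have hpos : 0 < 2 * π / q := by positivity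
    rw [← cos_two_pi_sub, arccos_cos (by linarith) (by linarith)] at h
    linarith

theorem re_exp_two_pi_div_zpow (q : ℕ) (a : ℤ) :
    (Complex.exp (2 * π * Complex.I / q) ^ a).re = cos (2 * π * a / q) := by
  rw [← Complex.exp_int_mul, ← Complex.exp_ofReal_mul_I_re]
  congr 2
  push_cast
  ring

/-- The canonical `C_q`-action on the unit sphere of `EuclideanSpace ℂ (Fin n)` is a strong
`r`-diameter action for `0 < r ≤ 2π/(q(q+1))`: if the orbits of unit vectors
`x 0, …, x k` have pairwise quotient distance `< r`, there are integers `a i` with `a 0 = 0`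
such that the representatives `ω^(a i) • x i` have pairwise sphere distance `< r`, and the
`a i` are unique modulo `q` among families with `d_S(x 0, ω^(b i) • x i) < r`. -/
theorem strong_r_diameter_action (n : ℕ) (hn : 1 ≤ n) (q : ℕ) (hq : 2 ≤ q)
    (ω : ℂ) (hω : ω = Complex.exp (2 * π * Complex.I / q))
    (r : ℝ) (hr₀ : 0 < r) (hr : r ≤ 2 * π / (q * (q + 1)))
    (k : ℕ) (x : Fin (k + 1) → EuclideanSpace ℂ (Fin n)) (hx : ∀ i, ‖x i‖ = 1)
    (horb : ∀ i j, ∃ a : ℤ, sphereDist (x i) (ω ^ a • x j) < r) :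
    ∃ a : Fin (k + 1) → ℤ, a 0 = 0 ∧
      (∀ i j, sphereDist (ω ^ a i • x i) (ω ^ a j • x j) < r) ∧
      ∀ b : Fin (k + 1) → ℤ,
        (∀ i, sphereDist (x 0) (ω ^ b i • x i) < r) →
        ∀ i, (q : ℤ) ∣ (b i - a i) := by
  have hω1 : ∀ a : ℤ, ‖ω ^ a‖ = 1 := by
    intro a
    have : 2 * π * Complex.I / q = ((2 * π / q : ℝ) : ℂ) * Complex.I := by
      push_cast
      ring
    rw [norm_zpow, hω, this, Complex.norm_exp_ofReal_mul_I, one_zpow]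
  have hω0 : ω ≠ 0 := hω ▸ Complex.exp_ne_zero _
  have hunit : ∀ (a : ℤ) i, ‖ω ^ a • x i‖ = 1 := fun a i => by rw [norm_smul, hω1, hx, one_mul]
  have hr3 : 3 * r ≤ 2 * π / q := by
    have hq2 : (2 : ℝ) ≤ q := by exact_mod_cast hq
    have hπ := pi_pos
    rw [le_div_iff₀ (by positivity)] at hr ⊢
    nlinarith [mul_nonneg (mul_nonneg hr₀.le (by positivity : (0 : ℝ) ≤ q)) (sub_nonneg.2 hq2)]
  have hsmall : ∀ (c d : ℤ) i, sphereDist (ω ^ c • x i) (ω ^ d • x i) < 3 * r →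
      (q : ℤ) ∣ d - c := by
    intro c d i h
    have hd : ω ^ d • x i = ω ^ (d - c) • ω ^ c • x i := by
      rw [smul_smul, ← zpow_add₀ hω0, sub_add_cancel]
    rw [hd, sphereDist_self_smul (hunit c i), hω, re_exp_two_pi_div_zpow] at h
    exact dvd_of_arccos_cos_lt hq (h.trans_le hr3)
  have hperiod : ∀ c d : ℤ, (q : ℤ) ∣ d - c → ω ^ d = ω ^ c := by
    rintro c d ⟨m, hm⟩
    have hωq : ω ^ q = 1 := by
      rw [hω]
      exact (Complex.isPrimitiveRoot_exp q (by omega)).pow_eq_one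
    rw [eq_add_of_sub_eq hm, zpow_add₀ hω0, zpow_mul, zpow_natCast, hωq, one_zpow, one_mul]
  choose f hf using horb 0
  set a : Fin (k + 1) → ℤ := Function.update f 0 0
  have ha0 : a 0 = 0 := by simp [a]
  have ha : ∀ i, sphereDist (x 0) (ω ^ a i • x i) < r := by
    intro i
    rcases eq_or_ne i 0 with rfl | hi
    · simpa [ha0, sphereDist_self (hx 0)] using hr₀
    · simpa [a, hi] using hf i
  refine ⟨a, ha0, fun i j => ?_, fun b hb i => ?_⟩
  · obtain ⟨c, hc⟩ := horb i j
    rw [← sphereDist_smul_smul (hω1 (a i)), smul_smul, ← zpow_add₀ hω0] at hc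
    have h1 := sphereDist_triangle (hunit (a j) j) (hx 0) (hunit (a i + c) j)
    have h2 := sphereDist_triangle (hx 0) (hunit (a i) i) (hunit (a i + c) j)
    have h3 := ha j
    rw [sphereDist_comm] at h3
    rwa [hperiod _ _ (hsmall (a j) (a i + c) j (by linarith [ha i]))] at hc
  · have h1 := sphereDist_triangle (hunit (a i) i) (hx 0) (hunit (b i) i)
    have h2 := ha i
    rw [sphereDist_comm] at h2
    exact hsmall _ _ i (by linarith [hb i])
end
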